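/- Let k be a positive integer and let Gauss diagrams G and G' be related by a single 2k-move, say G' is obtained from G by removing the 2k chords of a 2k-move configuration of sign ε ∈ {+1, −1}. Then there exists an integer n ≥ 0 such that J_m(G) = J_m(G') for every integer m with |m| ≠ n; moreover, if n ≠ 0 then J_n(G) − J_n(G') = εk and J_{−n}(G) − J_{−n}(G') = εk, while if n = 0 then J_0(G) − J_0(G') = 2εk. -/

import Mathlib

/-!
Combinatorial Gauss diagrams.

A Gauss diagram is encoded as a list of chord endpoints read along the
oriented circle from a basepoint.  Each endpoint records the (natural number)
label of its chord, whether it is the terminal endpoint of the (oriented)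
chord, and the sign of the chord (`true` = +1, `false` = -1).
Diagrams are considered up to rotation of the basepoint and relabeling of the
chords; these renamings are included among the "Reidemeister" generators.
-/

structure Endpoint where
  label : ℕ
  isTerminal : Bool
  sign : Bool
deriving DecidableEq

namespace Gauss

/-- The sign (±1) of the chord through an endpoint. -/
def signValue (e : Endpoint) : ℤ := if e.sign then 1 else -1

/-- The sign assigned to an endpoint: `ε` at the terminal endpoint and `-ε`
at the initial endpoint of a chord of sign `ε`. -/
def endpointValue (e : Endpoint) : ℤ := if e.isTerminal then signValue e else -signValue e

/-- The list of chord labels of the endpoints of a word. -/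
def labels (L : List Endpoint) : List ℕ := L.map Endpoint.label

/-- A word is a Gauss diagram when every chord label occurring in it occurs
exactly twice, once as an initial and once as a terminal endpoint, with the
same sign at both occurrences. -/
def IsGaussDiagram (L : List Endpoint) : Prop :=
  ∀ e ∈ L, (L.filter (fun x => x.label == e.label)).length = 2 ∧
    ∃ e' ∈ L, e'.label = e.label ∧ e'.isTerminal = !e.isTerminal ∧ e'.sign = e.sign

/-- Rotate a word so that the first endpoint satisfying `p` comes first. -/
def rotateTo (L : List Endpoint) (p : Endpoint → Bool) : List Endpoint :=
  match L.findIdx? p with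
  | some i => L.drop i ++ L.take i
  | none => L

/-- The index of the chord labeled `c`: the sum of the signs assigned to the
endpoints on the arc running from the initial endpoint of the chord to its
terminal endpoint in the direction of the circle's orientation. -/
def chordIndex (L : List Endpoint) (c : ℕ) : ℤ :=
  ((((rotateTo L (fun e => e.label == c && !e.isTerminal)).drop 1).takeWhile
      (fun e => e.label != c)).map endpointValue).sum

/-- `Jn L n`: the sum of the signs of the chords of `L` of index `n`. -/
def Jn (L : List Endpoint) (n : ℤ) : ℤ :=
  ((L.filter (fun e => e.isTerminal && decide (chordIndex L e.label = n))).map signValue).sum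

/-- The odd writhe: the sum of the signs of the chords of odd index,
i.e. `J = Σ_{n odd} J_n`. -/
def oddWrithe (L : List Endpoint) : ℤ :=
  ((L.filter (fun e => e.isTerminal && decide (chordIndex L e.label % 2 ≠ 0))).map signValue).sum

/-- Moving the basepoint of the circle. -/
def rotateStep (L L' : List Endpoint) : Prop :=
  ∃ x xs, L = x :: xs ∧ L' = xs ++ [x]

/-- Injective relabeling of the chords. -/
def relabelStep (L L' : List Endpoint) : Prop :=
  ∃ f : ℕ → ℕ, Function.Injective f ∧
    L' = L.map (fun e => Endpoint.mk (f e.label) e.isTerminal e.sign)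

/-- Reidemeister move I (removal direction): remove an isolated chord whose
two endpoints are adjacent (either orientation, either sign). -/
def reid1 (L L' : List Endpoint) : Prop :=
  ∃ (A B : List Endpoint) (c : ℕ) (t s : Bool),
    c ∉ labels (A ++ B) ∧
    L = A ++ [Endpoint.mk c t s, Endpoint.mk c (!t) s] ++ B ∧
    L' = A ++ B

/-- Reidemeister move II (removal direction): remove two chords of opposite
signs whose initial endpoints are adjacent and whose terminal endpoints are
adjacent (in either of the two admissible orders). -/
def reid2 (L L' : List Endpoint) : Prop :=
  ∃ (A B C : List Endpoint) (c d : ℕ) (s crossed : Bool),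
    c ≠ d ∧ c ∉ labels (A ++ B ++ C) ∧ d ∉ labels (A ++ B ++ C) ∧
    L = A ++ [Endpoint.mk c false s, Endpoint.mk d false (!s)] ++ B ++
        (if crossed then [Endpoint.mk c true s, Endpoint.mk d true (!s)]
         else [Endpoint.mk d true (!s), Endpoint.mk c true s]) ++ C ∧
    L' = A ++ B ++ C

/-- Reidemeister move III (a standard variant; together with the moves I, II,
rotations and relabelings it generates all versions of the third move). -/
def reid3 (L L' : List Endpoint) : Prop :=
  ∃ (A B C D : List Endpoint) (a b c : ℕ) (s : Bool),
    a ≠ b ∧ b ≠ c ∧ a ≠ c ∧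
    L = A ++ [Endpoint.mk b false s, Endpoint.mk a false s] ++ B ++
        [Endpoint.mk a true s, Endpoint.mk c false (!s)] ++ C ++
        [Endpoint.mk b true s, Endpoint.mk c true (!s)] ++ D ∧
    L' = A ++ [Endpoint.mk a false s, Endpoint.mk b false s] ++ B ++
        [Endpoint.mk c false (!s), Endpoint.mk a true s] ++ C ++
        [Endpoint.mk c true (!s), Endpoint.mk b true s] ++ D

/-- A single Reidemeister generator (including diagram renamings). -/
def reidStep (L L' : List Endpoint) : Prop :=
  rotateStep L L' ∨ relabelStep L L' ∨ reid1 L L' ∨ reid2 L L' ∨ reid3 L L'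

/-- A Ξ-move: exchange the first and third of three consecutive endpoints
belonging to three distinct chords, keeping all signs and orientations. -/
def xiStep (L L' : List Endpoint) : Prop :=
  ∃ (A B : List Endpoint) (x y z : Endpoint),
    x.label ≠ y.label ∧ y.label ≠ z.label ∧ x.label ≠ z.label ∧
    L = A ++ [x, y, z] ++ B ∧
    L' = A ++ [z, y, x] ++ B

/-- A 2k-move (removal direction): remove `2k` chords `c 0, …, c (2k-1)`, all
of sign `s`, whose `p`-endpoints appear consecutively on one arc and whose
`q`-endpoints appear consecutively on a disjoint arc, the chord `c i` being
oriented from `p` to `q` for even `i` (the paper's odd `i`, 1-indexed) and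
from `q` to `p` for odd `i`, so initial and terminal endpoints alternate. -/
def move2k (k : ℕ) (L L' : List Endpoint) : Prop :=
  ∃ (A B C : List Endpoint) (c : ℕ → ℕ) (s : Bool),
    (∀ i < 2 * k, ∀ j < 2 * k, c i = c j → i = j) ∧
    (∀ i < 2 * k, c i ∉ labels (A ++ B ++ C)) ∧
    L = A ++ (List.range (2 * k)).map (fun i => Endpoint.mk (c i) (decide (i % 2 = 1)) s)
          ++ B ++
        (List.range (2 * k)).map (fun i => Endpoint.mk (c i) (decide (i % 2 = 0)) s)
          ++ C ∧
    L' = A ++ B ++ C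

/-- A crossing change: reverse the sign and the orientation of one chord. -/
def crossingChange (L L' : List Endpoint) : Prop :=
  ∃ c : ℕ,
    L' = L.map (fun e =>
      if e.label = c then Endpoint.mk e.label (!e.isTerminal) (!e.sign) else e)

/-- Finite sequences of moves from `r`, performed in either direction. -/
def Moves (r : List Endpoint → List Endpoint → Prop) :
    List Endpoint → List Endpoint → Prop :=
  Relation.ReflTransGen (fun L L' => r L L' ∨ r L' L)

/-- Related by Reidemeister moves: the two words represent the same virtual knot. -/
def ReidEquiv : List Endpoint → List Endpoint → Prop := Moves reidStep

/-- Related by a finite sequence of 2k-moves (and Reidemeister moves). -/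
def Rel2k (k : ℕ) : List Endpoint → List Endpoint → Prop :=
  Moves (fun L L' => reidStep L L' ∨ move2k k L L')

/-- Related by a finite sequence of Ξ-moves (and Reidemeister moves). -/
def RelXi : List Endpoint → List Endpoint → Prop :=
  Moves (fun L L' => reidStep L L' ∨ xiStep L L')

/-- Related by a finite sequence of 2k-moves and Ξ-moves (and Reidemeister moves). -/
def Rel2kXi (k : ℕ) : List Endpoint → List Endpoint → Prop :=
  Moves (fun L L' => reidStep L L' ∨ move2k k L L' ∨ xiStep L L')

/-- Related by a finite sequence of crossing changes and Ξ-moves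
(and Reidemeister moves). -/
def RelCCXi : List Endpoint → List Endpoint → Prop :=
  Moves (fun L L' => reidStep L L' ∨ crossingChange L L' ∨ xiStep L L')

/-- A shell-pair of sign `s`: two chords `c`, `d` of sign `s` whose four
endpoints are consecutive, interleaved as 1st-3rd and 2nd-4th
(with arbitrary orientations `t`, `u` of the two shells). -/
def shellPair (c d : ℕ) (t u s : Bool) : List Endpoint :=
  [Endpoint.mk c t s, Endpoint.mk d u s, Endpoint.mk c (!t) s, Endpoint.mk d (!u) s]

/-- The Gauss diagram `G(a)`: `|a|` consecutive shell-pairs of sign `+1` if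
`a > 0` and of sign `-1` if `a < 0`; `G(0)` has no chords.  It represents the
virtual knot `K(a)`. -/
def Gword (a : ℤ) : List Endpoint :=
  ((List.range a.natAbs).map
    (fun j => shellPair (2 * j) (2 * j + 1) false false (decide (0 < a)))).flatten

/-- `Rel2kCount k m G G'`: `G` and `G'` are related by a finite sequence of
Reidemeister moves and exactly `m` 2k-moves. -/
inductive Rel2kCount (k : ℕ) : ℕ → List Endpoint → List Endpoint → Prop
  | refl (L : List Endpoint) : Rel2kCount k 0 L L
  | reid {m : ℕ} {L L' L'' : List Endpoint} :
      reidStep L L' ∨ reidStep L' L →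
      Rel2kCount k m L' L'' → Rel2kCount k m L L''
  | move {m : ℕ} {L L' L'' : List Endpoint} :
      move2k k L L' ∨ move2k k L' L →
      Rel2kCount k m L' L'' → Rel2kCount k (m + 1) L L''

/-- The 2k-move distance: the minimal number of 2k-moves needed to relate the
two diagrams (together with Reidemeister moves). -/
noncomputable def dist2k (k : ℕ) (L L' : List Endpoint) : ℕ :=
  sInf {m | Rel2kCount k m L L'}

end Gauss

namespace Gauss

/-- total value of a word -/
def vsum (L : List Endpoint) : ℤ := (L.map endpointValue).sum

theorem vsum_append (X Y : List Endpoint) : vsum (X ++ Y) = vsum X + vsum Y := by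
  simp [vsum]

theorem rotateTo_split (X Y : List Endpoint) (u : Endpoint) (p : Endpoint → Bool)
    (hX : ∀ x ∈ X, p x = false) (hu : p u = true) :
    rotateTo (X ++ u :: Y) p = u :: (Y ++ X) := by
  have h : (X ++ u :: Y).findIdx? p = some X.length := by
    rw [List.findIdx?_append]
    have : X.findIdx? p = none := by
      rw [List.findIdx?_eq_none_iff]; exact hX
    simp [this, List.findIdx?_cons, hu]
  simp [rotateTo, h]

theorem exists_first_split (L : List Endpoint) (p : Endpoint → Bool) (h : ∃ x ∈ L, p x = true) :
    ∃ X u Y, L = X ++ u :: Y ∧ (∀ x ∈ X, p x = false) ∧ p u = true := by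
  induction L with
  | nil => simp at h
  | cons a L ih =>
    by_cases ha : p a = true
    · exact ⟨[], a, L, by simp, by simp, ha⟩
    · obtain ⟨x, hx, hpx⟩ := h
      have hx' : x ∈ L := by
        rcases List.mem_cons.1 hx with rfl | h'
        · exact absurd hpx ha
        · exact h'
      obtain ⟨X, u, Y, rfl, h1, h2⟩ := ih ⟨x, hx', hpx⟩
      refine ⟨a :: X, u, Y, by simp, ?_, h2⟩
      intro y hy
      rcases List.mem_cons.1 hy with rfl | h'
      · simpa using ha
      · exact h1 y h'

theorem takeWhile_insert (X P Y : List Endpoint) (q : Endpoint → Bool)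
    (hP : ∀ x ∈ P, q x = true) (hs : vsum P = 0) :
    vsum ((X ++ P ++ Y).takeWhile q) = vsum ((X ++ Y).takeWhile q) := by
  induction X with
  | nil =>
    simp only [List.nil_append]
    rw [List.takeWhile_append_of_pos hP, vsum_append, hs, zero_add]
  | cons a X ih =>
    simp only [List.cons_append, List.takeWhile_cons]
    split
    · simp only [vsum, List.map_cons, List.sum_cons] at *
      rw [ih]
    · rfl

theorem chordIndex_split (X Y : List Endpoint) (u : Endpoint) (c : ℕ)
    (hX : ∀ x ∈ X, (x.label == c && !x.isTerminal) = false)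
    (hu : (u.label == c && !u.isTerminal) = true) :
    chordIndex (X ++ u :: Y) c = vsum ((Y ++ X).takeWhile (fun e => e.label != c)) := by
  unfold chordIndex
  rw [rotateTo_split X Y u _ hX hu]
  simp [vsum]

theorem chordIndex_split_two (X Y R W : List Endpoint) (u v : Endpoint) (c : ℕ)
    (hX : ∀ x ∈ X, (x.label == c && !x.isTerminal) = false)
    (hu : (u.label == c && !u.isTerminal) = true)
    (hYX : Y ++ X = R ++ v :: W) (hR : ∀ x ∈ R, x.label ≠ c) (hv : v.label = c) :
    chordIndex (X ++ u :: Y) c = vsum R := by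
  rw [chordIndex_split X Y u c hX hu, hYX, List.takeWhile_append_of_pos]
  · simp [hv]
  · intro x hx; simpa using hR x hx

theorem chordIndex_insert (X P Y : List Endpoint) (c : ℕ)
    (hP : ∀ x ∈ P, x.label ≠ c) (hs : vsum P = 0)
    (h : ∃ e ∈ X ++ Y, e.label = c ∧ e.isTerminal = false) :
    chordIndex (X ++ P ++ Y) c = chordIndex (X ++ Y) c := by
  have hPq : ∀ x ∈ P, (fun e : Endpoint => e.label != c) x = true := by
    intro x hx; simpa using hP x hx
  by_cases hX : ∃ x ∈ X, (x.label == c && !x.isTerminal) = true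
  · obtain ⟨X1, u, X2, rfl, h1, h2⟩ :=
      exists_first_split X (fun x => x.label == c && !x.isTerminal) hX
    have e1 : X1 ++ u :: X2 ++ P ++ Y = X1 ++ u :: (X2 ++ P ++ Y) := by simp
    have e2 : X1 ++ u :: X2 ++ Y = X1 ++ u :: (X2 ++ Y) := by simp
    rw [e1, e2, chordIndex_split _ _ u c h1 h2, chordIndex_split _ _ u c h1 h2]
    have := takeWhile_insert X2 P (Y ++ X1) _ hPq hs
    simpa using this
  · have hX' : ∀ x ∈ X, (x.label == c && !x.isTerminal) = false := by
      intro x hx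
      by_contra hh
      exact hX ⟨x, hx, by simpa using hh⟩
    have hY : ∃ x ∈ Y, (x.label == c && !x.isTerminal) = true := by
      obtain ⟨e, he, h1, h2⟩ := h
      rcases List.mem_append.1 he with h' | h'
      · have := hX' e h'
        simp [h1, h2] at this
      · exact ⟨e, h', by simp [h1, h2]⟩
    obtain ⟨Y1, u, Y2, rfl, h1, h2⟩ :=
      exists_first_split Y (fun x => x.label == c && !x.isTerminal) hY
    have e1 : X ++ P ++ (Y1 ++ u :: Y2) = (X ++ P ++ Y1) ++ u :: Y2 := by simp
    have e2 : X ++ (Y1 ++ u :: Y2) = (X ++ Y1) ++ u :: Y2 := by simp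
    have hXY : ∀ x ∈ X ++ Y1, (x.label == c && !x.isTerminal) = false := by
      intro x hx
      rcases List.mem_append.1 hx with h' | h'
      · exact hX' x h'
      · exact h1 x h'
    have hXPY : ∀ x ∈ X ++ P ++ Y1, (x.label == c && !x.isTerminal) = false := by
      intro x hx
      rcases List.mem_append.1 hx with h' | h'
      · rcases List.mem_append.1 h' with h'' | h''
        · exact hX' x h''
        · simp [hP x h'']
      · exact h1 x h'
    rw [e1, e2, chordIndex_split _ _ u c hXPY h2, chordIndex_split _ _ u c hXY h2]
    have := takeWhile_insert (Y2 ++ X) P Y1 _ hPq hs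
    simpa using this

theorem vsum_filter (L : List Endpoint) (p : Endpoint → Bool) :
    vsum L = vsum (L.filter p) + vsum (L.filter (fun x => !p x)) := by
  induction L with
  | nil => simp [vsum]
  | cons a L ih =>
    cases h : p a <;> simp [List.filter_cons, h, vsum] at * <;> linarith

theorem vsum_valid_aux (n : ℕ) : ∀ L : List Endpoint, L.length ≤ n → IsGaussDiagram L →
    vsum L = 0 := by
  induction n with
  | zero =>
    intro L hL _
    have : L = [] := by simpa using hL
    simp [this, vsum]
  | succ n ih =>
    intro L hL hv
    rcases L with _ | ⟨e, T⟩
    · simp [vsum]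
    obtain ⟨h2, e', he', hl, ht, hs⟩ := hv e (by simp)
    rw [vsum_filter (e :: T) (fun x => x.label == e.label)]
    have hsum : vsum ((e :: T).filter (fun x => x.label == e.label)) = 0 := by
      have hm : e' ∈ (e :: T).filter (fun x => x.label == e.label) := by
        rw [List.mem_filter]; exact ⟨he', by simp [hl]⟩
      have hhead : (e :: T).filter (fun x => x.label == e.label)
          = e :: T.filter (fun x => x.label == e.label) := by simp
      rw [hhead] at h2 hm ⊢
      have h1 : (T.filter (fun x => x.label == e.label)).length = 1 := by simpa using h2
      obtain ⟨z, hz⟩ := List.length_eq_one_iff.1 h1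
      rw [hz] at hm ⊢
      have hez : e' = z := by
        rcases List.mem_cons.1 hm with h | h
        · rw [h] at ht; simp at ht
        · simpa using h
      subst hez
      cases hb : e.isTerminal <;> simp [vsum, endpointValue, signValue, ht, hs, hb]
    rw [hsum, zero_add]
    apply ih
    · have : ((e :: T).filter (fun x => !(x.label == e.label))).length ≤ T.length := by
        simp only [List.filter_cons]
        simpa using List.length_filter_le _ T
      simp at hL
      omega
    · intro x hx
      rw [List.mem_filter] at hx
      obtain ⟨hxL, hxe⟩ := hx
      have hxe' : x.label ≠ e.label := by simpa using hxe
      obtain ⟨h3, x', hx', hl', ht', hs'⟩ := hv x hxL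
      refine ⟨?_, x', ?_, hl', ht', hs'⟩
      · rw [← h3, List.filter_filter]
        congr 1
        apply List.filter_congr
        intro y _
        by_cases hy : y.label = x.label
        · simp [hy, hxe']
        · simp [hy]
      · rw [List.mem_filter]
        exact ⟨hx', by simpa [hl'] using hxe'⟩

theorem vsum_valid (L : List Endpoint) (h : IsGaussDiagram L) : vsum L = 0 :=
  vsum_valid_aux L.length L le_rfl h

theorem alt_sum (a : ℤ) (n : ℕ) : ∀ s : ℕ,
    ((List.range' s n).map (fun i => if i % 2 = 1 then a else -a)).sum
      = if n % 2 = 0 then 0 else if s % 2 = 1 then a else -a := by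
  induction n with
  | zero => intro s; simp
  | succ n ih =>
    intro s
    rw [List.range'_succ, List.map_cons, List.sum_cons, ih]
    split_ifs <;> omega

theorem count_sum (a b : ℤ) (k : ℕ) :
    ((List.range (2 * k)).map (fun i => if i % 2 = 1 then a else b)).sum = k * (a + b) := by
  induction k with
  | zero => simp
  | succ k ih =>
    rw [show 2 * (k + 1) = 2 * k + 1 + 1 by ring, List.range_succ, List.range_succ]
    simp only [List.map_append, List.sum_append, ih]
    have h1 : (2 * k) % 2 ≠ 1 := by omega
    have h2 : (2 * k + 1) % 2 = 1 := by omega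
    simp [h2]
    ring

theorem range_split (N i : ℕ) (h : i < N) :
    List.range N = List.range' 0 i ++ i :: List.range' (i + 1) (N - 1 - i) := by
  rw [← List.range'_succ, List.range_eq_range', show N = i + (N - 1 - i + 1) by omega]
  rw [← List.range'_append]
  simp
  

/-- the p-block over an index list -/
def pb (c : ℕ → ℕ) (s : Bool) (I : List ℕ) : List Endpoint :=
  I.map (fun i => Endpoint.mk (c i) (decide (i % 2 = 1)) s)

/-- the q-block over an index list -/
def qb (c : ℕ → ℕ) (s : Bool) (I : List ℕ) : List Endpoint :=
  I.map (fun i => Endpoint.mk (c i) (decide (i % 2 = 0)) s)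

/-- numeric sign -/
def sg (s : Bool) : ℤ := if s then 1 else -1

theorem vsum_pb (c : ℕ → ℕ) (s : Bool) (a n : ℕ) : vsum (pb c s (List.range' a n)) =
    if n % 2 = 0 then 0 else if a % 2 = 1 then sg s else -sg s := by
  rw [← alt_sum]
  simp only [vsum, pb, List.map_map]
  congr 1
  apply List.map_congr_left
  intro i _
  simp [endpointValue, signValue, sg]

theorem vsum_qb (c : ℕ → ℕ) (s : Bool) (a n : ℕ) : vsum (qb c s (List.range' a n)) =
    if n % 2 = 0 then 0 else if a % 2 = 1 then -sg s else sg s := by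
  have := alt_sum (-sg s) n a
  rw [neg_neg] at this
  rw [← this]
  simp only [vsum, qb, List.map_map]
  congr 1
  apply List.map_congr_left
  intro i _
  rcases Nat.mod_two_eq_zero_or_one i with h | h <;> simp [endpointValue, signValue, sg, h]

theorem sum_filter_ite (L : List Endpoint) (p : Endpoint → Bool) :
    ((L.filter p).map signValue).sum = (L.map (fun e => if p e then signValue e else 0)).sum := by
  induction L with
  | nil => simp
  | cons a L ih => cases h : p a <;> simp [h, ih]

theorem Jn_eq (L : List Endpoint) (n : ℤ) : Jn L n =
    (L.map (fun e => if e.isTerminal && decide (chordIndex L e.label = n)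
      then signValue e else 0)).sum := by
  unfold Jn
  exact sum_filter_ite L (fun e => e.isTerminal && decide (chordIndex L e.label = n))

theorem mem_pb {c : ℕ → ℕ} {s : Bool} {I : List ℕ} {x : Endpoint} :
    x ∈ pb c s I ↔ ∃ i ∈ I, Endpoint.mk (c i) (decide (i % 2 = 1)) s = x := by simp [pb]

theorem mem_qb {c : ℕ → ℕ} {s : Bool} {I : List ℕ} {x : Endpoint} :
    x ∈ qb c s I ↔ ∃ i ∈ I, Endpoint.mk (c i) (decide (i % 2 = 0)) s = x := by simp [qb]

section
variable (k : ℕ) (A B C : List Endpoint) (c : ℕ → ℕ) (s : Bool)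
    (hinj : ∀ i < 2 * k, ∀ j < 2 * k, c i = c j → i = j)
    (hfresh : ∀ i < 2 * k, ∀ x ∈ A ++ B ++ C, x.label ≠ c i)

theorem idx_even (hinj : ∀ i < 2 * k, ∀ j < 2 * k, c i = c j → i = j)
    (hfresh : ∀ i < 2 * k, ∀ x ∈ A ++ B ++ C, x.label ≠ c i) (i : ℕ) (hi : i < 2 * k) (he : i % 2 = 0) :
    chordIndex (A ++ pb c s (List.range (2 * k)) ++ B ++ qb c s (List.range (2 * k)) ++ C) (c i)
      = vsum B + sg s := by
  have hf := hfresh i hi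
  have hA : ∀ x ∈ A, x.label ≠ c i := fun x hx => hf x (by simp [hx])
  have hB : ∀ x ∈ B, x.label ≠ c i := fun x hx => hf x (by simp [hx])
  have hlo : ∀ j ∈ List.range' 0 i, c j ≠ c i := by
    intro j hj h
    have hj' : j < i := by simpa using hj
    have := hinj j (by omega) i hi h
    omega
  have hhi : ∀ j ∈ List.range' (i + 1) (2 * k - 1 - i), c j ≠ c i := by
    intro j hj h
    rw [List.mem_range'_1] at hj
    have := hinj j (by omega) i hi h
    omega
  have key := chordIndex_split_two (A ++ pb c s (List.range' 0 i))
    (pb c s (List.range' (i + 1) (2 * k - 1 - i)) ++ B ++ qb c s (List.range (2 * k)) ++ C)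
    (pb c s (List.range' (i + 1) (2 * k - 1 - i)) ++ B ++ qb c s (List.range' 0 i))
    (qb c s (List.range' (i + 1) (2 * k - 1 - i)) ++ C ++ (A ++ pb c s (List.range' 0 i)))
    ⟨c i, decide (i % 2 = 1), s⟩ ⟨c i, decide (i % 2 = 0), s⟩ (c i)
    (by
      intro x hx
      have : x.label ≠ c i := by
        rcases List.mem_append.1 hx with h | h
        · exact hA x h
        · obtain ⟨j, hj, rfl⟩ := mem_pb.1 h
          exact hlo j hj
      simp [this])
    (by simp [he])
    (by rw [range_split _ i hi]; simp [qb])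
    (by
      intro x hx
      rcases List.mem_append.1 hx with h | h
      · rcases List.mem_append.1 h with h | h
        · obtain ⟨j, hj, rfl⟩ := mem_pb.1 h
          exact hhi j hj
        · exact hB x h
      · obtain ⟨j, hj, rfl⟩ := mem_qb.1 h
        exact hlo j hj)
    rfl
  rw [vsum_append, vsum_append, vsum_pb, vsum_qb] at key
  rw [if_neg (by omega), if_pos (by omega), if_pos he] at key
  rw [show vsum B + sg s = sg s + vsum B + 0 by ring, ← key]
  congr 1
  conv_lhs => rw [show pb c s (List.range (2 * k)) = pb c s (List.range' 0 i) ++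
    ⟨c i, decide (i % 2 = 1), s⟩ :: pb c s (List.range' (i + 1) (2 * k - 1 - i)) by
      rw [range_split _ i hi]; simp [pb]]
  simp

theorem idx_odd (hinj : ∀ i < 2 * k, ∀ j < 2 * k, c i = c j → i = j)
    (hfresh : ∀ i < 2 * k, ∀ x ∈ A ++ B ++ C, x.label ≠ c i) (i : ℕ) (hi : i < 2 * k) (he : i % 2 = 1) :
    chordIndex (A ++ pb c s (List.range (2 * k)) ++ B ++ qb c s (List.range (2 * k)) ++ C) (c i)
      = vsum C + vsum A - sg s := by
  have hf := hfresh i hi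
  have hA : ∀ x ∈ A, x.label ≠ c i := fun x hx => hf x (by simp [hx])
  have hB : ∀ x ∈ B, x.label ≠ c i := fun x hx => hf x (by simp [hx])
  have hC : ∀ x ∈ C, x.label ≠ c i := fun x hx => hf x (by simp [hx])
  have hlo : ∀ j ∈ List.range' 0 i, c j ≠ c i := by
    intro j hj h
    have hj' : j < i := by simpa using hj
    have := hinj j (by omega) i hi h
    omega
  have hhi : ∀ j ∈ List.range' (i + 1) (2 * k - 1 - i), c j ≠ c i := by
    intro j hj h
    rw [List.mem_range'_1] at hj
    have := hinj j (by omega) i hi h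
    omega
  have key := chordIndex_split_two
    (A ++ pb c s (List.range (2 * k)) ++ B ++ qb c s (List.range' 0 i))
    (qb c s (List.range' (i + 1) (2 * k - 1 - i)) ++ C)
    (qb c s (List.range' (i + 1) (2 * k - 1 - i)) ++ C ++ A ++ pb c s (List.range' 0 i))
    (pb c s (List.range' (i + 1) (2 * k - 1 - i)) ++ B ++ qb c s (List.range' 0 i))
    ⟨c i, decide (i % 2 = 0), s⟩ ⟨c i, decide (i % 2 = 1), s⟩ (c i)
    (by
      intro x hx
      rcases List.mem_append.1 hx with h | h
      · rcases List.mem_append.1 h with h | h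
        · rcases List.mem_append.1 h with h | h
          · simp [hA x h]
          · obtain ⟨j, hj, rfl⟩ := mem_pb.1 h
            by_cases hji : c j = c i
            · have := hinj j (by simpa using hj) i hi hji
              simp [this, he]
            · simp [hji]
        · simp [hB x h]
      · obtain ⟨j, hj, rfl⟩ := mem_qb.1 h
        simp [hlo j hj])
    (by simp [he])
    (by rw [range_split _ i hi]; simp [pb])
    (by
      intro x hx
      rcases List.mem_append.1 hx with h | h
      · rcases List.mem_append.1 h with h | h
        · rcases List.mem_append.1 h with h | h
          · obtain ⟨j, hj, rfl⟩ := mem_qb.1 h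
            exact hhi j hj
          · exact hC x h
        · exact hA x h
      · obtain ⟨j, hj, rfl⟩ := mem_pb.1 h
        exact hlo j hj)
    rfl
  rw [vsum_append, vsum_append, vsum_append, vsum_pb, vsum_qb] at key
  rw [if_pos (by omega), if_neg (by omega), if_neg (by omega)] at key
  rw [show vsum C + vsum A - sg s = 0 + vsum C + vsum A + -sg s by ring, ← key]
  congr 1
  rw [show qb c s (List.range (2 * k)) = qb c s (List.range' 0 i) ++
    ⟨c i, decide (i % 2 = 0), s⟩ :: qb c s (List.range' (i + 1) (2 * k - 1 - i)) by
      rw [range_split _ i hi]; simp [qb]]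
  simp

end

theorem Jn_diff (k : ℕ) (A B C G : List Endpoint) (c : ℕ → ℕ) (s : Bool)
    (hinj : ∀ i < 2 * k, ∀ j < 2 * k, c i = c j → i = j)
    (hfresh : ∀ i < 2 * k, ∀ x ∈ A ++ B ++ C, x.label ≠ c i)
    (hG : G = A ++ pb c s (List.range (2 * k)) ++ B ++ qb c s (List.range (2 * k)) ++ C)
    (hvalid : IsGaussDiagram G) (m : ℤ) :
    Jn G m - Jn (A ++ B ++ C) m =
      k * ((if -(vsum B + sg s) = m then sg s else 0) +
        (if vsum B + sg s = m then sg s else 0)) := by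
  have hP0 : vsum (pb c s (List.range (2 * k))) = 0 := by
    rw [List.range_eq_range', vsum_pb]; simp
  have hQ0 : vsum (qb c s (List.range (2 * k))) = 0 := by
    rw [List.range_eq_range', vsum_qb]; simp
  have htot : vsum A + vsum B + vsum C = 0 := by
    have := vsum_valid G hvalid
    rw [hG] at this
    simp only [vsum_append, hP0, hQ0] at this
    linarith
  have hold : ∀ e ∈ A ++ B ++ C, e.isTerminal = true →
      chordIndex G e.label = chordIndex (A ++ B ++ C) e.label := by
    intro e he het
    have hnp : ∀ x ∈ pb c s (List.range (2 * k)), x.label ≠ e.label := by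
      intro x hx h
      obtain ⟨j, hj, rfl⟩ := mem_pb.1 hx
      exact hfresh j (by simpa using hj) e he h.symm
    have hnq : ∀ x ∈ qb c s (List.range (2 * k)), x.label ≠ e.label := by
      intro x hx h
      obtain ⟨j, hj, rfl⟩ := mem_qb.1 hx
      exact hfresh j (by simpa using hj) e he h.symm
    have heG : e ∈ G := by
      rw [hG]; simp only [List.mem_append] at he ⊢; tauto
    obtain ⟨-, e', he', hl, ht, -⟩ := hvalid e heG
    have hmem : e' ∈ A ++ B ++ C := by
      have h1 := hnp e'
      have h2 := hnq e'
      rw [hG] at he'; simp only [List.mem_append] at he' ⊢; tauto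
    have hmem' := hmem
    simp only [List.mem_append] at hmem'
    have ht' : e'.isTerminal = false := by simp [ht, het]
    rw [hG, chordIndex_insert _ _ _ _ hnq hQ0
      ⟨e', by simp only [List.mem_append]; tauto, hl, ht'⟩]
    have := chordIndex_insert A _ (B ++ C) _ hnp hP0
      ⟨e', by simp only [List.mem_append]; tauto, hl, ht'⟩
    simpa using this
  rw [Jn_eq, Jn_eq (A ++ B ++ C)]
  have hcong : ∀ X : List Endpoint, (∀ x ∈ X, x ∈ A ++ B ++ C) →
      (X.map (fun e => if e.isTerminal && decide (chordIndex G e.label = m)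
        then signValue e else 0)).sum =
      (X.map (fun e => if e.isTerminal && decide (chordIndex (A ++ B ++ C) e.label = m)
        then signValue e else 0)).sum := by
    intro X hX
    congr 1
    apply List.map_congr_left
    intro e he
    cases ht : e.isTerminal
    · simp
    · rw [hold e (hX e he) ht]
  have hPs : ((pb c s (List.range (2 * k))).map
      (fun e => if e.isTerminal && decide (chordIndex G e.label = m)
        then signValue e else 0)).sum = k * (if -(vsum B + sg s) = m then sg s else 0) := by
    have := count_sum (if -(vsum B + sg s) = m then sg s else 0) 0 k
    rw [add_zero] at this
    rw [← this, pb, List.map_map]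
    congr 1
    apply List.map_congr_left
    intro i hi
    have hi' : i < 2 * k := by simpa using hi
    by_cases ho : i % 2 = 1
    · have h1 := idx_odd k A B C c s hinj hfresh i hi' ho
      rw [← hG, show vsum C + vsum A - sg s = -(vsum B + sg s) by linarith] at h1
      simp only [Function.comp, h1, ho]
      simp [signValue, sg]
    · simp [ho]
  have hQs : ((qb c s (List.range (2 * k))).map
      (fun e => if e.isTerminal && decide (chordIndex G e.label = m)
        then signValue e else 0)).sum = k * (if vsum B + sg s = m then sg s else 0) := by
    have := count_sum 0 (if vsum B + sg s = m then sg s else 0) k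
    rw [zero_add] at this
    rw [← this, qb, List.map_map]
    congr 1
    apply List.map_congr_left
    intro i hi
    have hi' : i < 2 * k := by simpa using hi
    by_cases ho : i % 2 = 0
    · have h1 := idx_even k A B C c s hinj hfresh i hi' ho
      rw [← hG] at h1
      simp only [Function.comp, h1, ho]
      by_cases hm : vsum B + sg s = m
      · simp [hm]; simp [signValue, sg]
      · simp [hm]
    · have ho' : i % 2 = 1 := by omega
      simp [ho']
  have hsplit : (G.map (fun e => if e.isTerminal && decide (chordIndex G e.label = m)
        then signValue e else 0)).sum =
      (A.map (fun e => if e.isTerminal && decide (chordIndex G e.label = m)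
        then signValue e else 0)).sum +
      ((pb c s (List.range (2 * k))).map
        (fun e => if e.isTerminal && decide (chordIndex G e.label = m)
        then signValue e else 0)).sum +
      (B.map (fun e => if e.isTerminal && decide (chordIndex G e.label = m)
        then signValue e else 0)).sum +
      ((qb c s (List.range (2 * k))).map
        (fun e => if e.isTerminal && decide (chordIndex G e.label = m)
        then signValue e else 0)).sum +
      (C.map (fun e => if e.isTerminal && decide (chordIndex G e.label = m)
        then signValue e else 0)).sum := by
    generalize (fun e : Endpoint => if e.isTerminal && decide (chordIndex G e.label = m)
        then signValue e else 0) = f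
    rw [hG]
    simp only [List.map_append, List.sum_append]
  rw [hsplit, hPs, hQs, hcong A (by intro x hx; simp [hx]), hcong B (by intro x hx; simp [hx]),
    hcong C (by intro x hx; simp [hx])]
  generalize (fun e : Endpoint => if e.isTerminal && decide (chordIndex (A ++ B ++ C) e.label = m)
        then signValue e else 0) = f
  simp only [List.map_append, List.sum_append]
  ring

end Gauss

open Gauss in
/-- if `G'` is obtained from `G` by removing the 2k chords of a
2k-move configuration of sign `s`, then there is an `n ≥ 0` with
`J_m(G) = J_m(G')` whenever `|m| ≠ n`, and `J_{±n}(G) - J_{±n}(G') = εk` if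
`n ≠ 0`, while `J_0(G) - J_0(G') = 2εk` if `n = 0` (where `ε = ±1` is `s`). -/
theorem jn_of_single_move2k (k : ℕ) (hk : 0 < k)
    (G G' A B C : List Endpoint) (c : ℕ → ℕ) (s : Bool)
    (hinj : ∀ i < 2 * k, ∀ j < 2 * k, c i = c j → i = j)
    (hfresh : ∀ i < 2 * k, c i ∉ labels (A ++ B ++ C))
    (hG : G = A ++ (List.range (2 * k)).map
            (fun i => Endpoint.mk (c i) (decide (i % 2 = 1)) s) ++ B ++
          (List.range (2 * k)).map
            (fun i => Endpoint.mk (c i) (decide (i % 2 = 0)) s) ++ C)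
    (hG' : G' = A ++ B ++ C)
    (hvalid : IsGaussDiagram G) :
    ∃ n : ℤ, 0 ≤ n ∧
      (∀ m : ℤ, |m| ≠ n → Jn G m = Jn G' m) ∧
      (n ≠ 0 →
        Jn G n - Jn G' n = (if s then 1 else -1) * k ∧
        Jn G (-n) - Jn G' (-n) = (if s then 1 else -1) * k) ∧
      (n = 0 → Jn G 0 - Jn G' 0 = 2 * (if s then 1 else -1) * k) := by
  have hfresh' : ∀ i < 2 * k, ∀ x ∈ A ++ B ++ C, x.label ≠ c i := by
    intro i hi x hx h
    apply hfresh i hi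
    rw [← h]
    exact List.mem_map_of_mem hx
  have key : ∀ m : ℤ, _ := fun m => Jn_diff k A B C G c s hinj hfresh' hG hvalid m
  subst hG'
  have hs : (if s then 1 else -1 : ℤ) = sg s := rfl
  rw [hs]
  generalize vsum B + sg s = x at key
  refine ⟨|x|, abs_nonneg x, ?_, ?_, ?_⟩
  · intro m hm
    have h := key m
    rw [if_neg (by rintro rfl; simp at hm), if_neg (by rintro rfl; simp at hm)] at h
    linarith
  · intro hx
    have hx0 : x ≠ 0 := by simpa using hx
    have h1 := key x
    have h2 := key (-x)
    rw [if_neg (by omega), if_pos rfl] at h1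
    rw [if_pos rfl, if_neg (by omega)] at h2
    rcases abs_choice x with h | h <;> rw [h]
    · constructor <;> linarith
    · rw [neg_neg]; constructor <;> linarith
  · intro hx
    have hx0 : x = 0 := by simpa using hx
    have h1 := key 0
    simp only [hx0, neg_zero, if_true] at h1
    rw [h1]; ring
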